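/- Under Condition 3 with 0 < d₁ < 1, there exist constants M₀ > 0 and M₀'' > 0 such that for all sufficiently large p: c_p/(a_p − c_p) ≤ M₀ and c_p ≥ M₀''; in particular limsup_{p→∞} c_p/a_p < 1. -/

import Mathlib

open MeasureTheory Filter

/-- Left edge of the Marchenko–Pastur type law with ratio `d`. -/
noncomputable def aMP (d : ℝ) : ℝ := (1 - Real.sqrt d) ^ 2

/-- Right edge of the Marchenko–Pastur type law with ratio `d`. -/
noncomputable def bMP (d : ℝ) : ℝ := (1 + Real.sqrt d) ^ 2

/-- The Marchenko–Pastur type density `ϱ_d`. -/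
noncomputable def rhoMP (d x : ℝ) : ℝ :=
  if aMP d ≤ x ∧ x ≤ bMP d then
    (1 / (2 * Real.pi * d * x)) * Real.sqrt ((bMP d - x) * (x - aMP d))
  else 0

/-- The edges of the Marchenko–Pastur law with ratio `d` differ by `4√d`. -/
lemma bMP_eq_aMP_add (d : ℝ) : bMP d = aMP d + 4 * Real.sqrt d := by
  unfold aMP bMP; ring

lemma aMP_pos {d : ℝ} (hd1 : d < 1) : 0 < aMP d := by
  have h : Real.sqrt d < 1 := (Real.sqrt_lt' one_pos).2 (by simpa using hd1)
  unfold aMP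
  have : 0 < 1 - Real.sqrt d := by linarith
  positivity

lemma aMP_le_one {d : ℝ} (hd1 : d ≤ 1) : aMP d ≤ 1 := by
  have h : Real.sqrt d ≤ 1 := Real.sqrt_le_one.2 hd1
  have h0 := Real.sqrt_nonneg d
  unfold aMP
  nlinarith

lemma aMP_anti {d e : ℝ} (hde : d ≤ e) (he : e ≤ 1) : aMP e ≤ aMP d := by
  have h : Real.sqrt e ≤ 1 := Real.sqrt_le_one.2 he
  have h1 := Real.sqrt_le_sqrt hde
  unfold aMP
  nlinarith

lemma bMP_le_four {d : ℝ} (hd1 : d ≤ 1) : bMP d ≤ 4 := by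
  have h : Real.sqrt d ≤ 1 := Real.sqrt_le_one.2 hd1
  have h0 := Real.sqrt_nonneg d
  unfold bMP
  nlinarith

lemma aMP_le_bMP (d : ℝ) : aMP d ≤ bMP d := by
  have := Real.sqrt_nonneg d
  rw [bMP_eq_aMP_add]; linarith

lemma rhoMP_nonneg {d : ℝ} (hd0 : 0 < d) (hd1 : d < 1) (x : ℝ) : 0 ≤ rhoMP d x := by
  unfold rhoMP
  split_ifs with h
  · have := (aMP_pos hd1).trans_le h.1
    positivity
  · exact le_rfl

lemma intervalIntegrable_sq_div_mul_rhoMP {d c : ℝ} (hd0 : 0 < d) (hd1 : d < 1)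
    (hc : c < aMP d) :
    IntervalIntegrable (fun x => (c / (x - c)) ^ 2 * rhoMP d x) volume (aMP d) (bMP d) := by
  have ha := aMP_pos hd1
  apply ContinuousOn.intervalIntegrable
  rw [Set.uIcc_of_le (aMP_le_bMP d)]
  have : ContinuousOn (fun x => (c / (x - c)) ^ 2 *
      ((1 / (2 * Real.pi * d * x)) * Real.sqrt ((bMP d - x) * (x - aMP d))))
      (Set.Icc (aMP d) (bMP d)) := by
    apply ContinuousOn.mul
    · apply ContinuousOn.pow
      apply ContinuousOn.div (by fun_prop) (by fun_prop)
      intro x hx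
      have := hx.1
      exact (by linarith : 0 < x - c).ne'
    · apply ContinuousOn.mul _ (by fun_prop)
      apply ContinuousOn.div (by fun_prop) (by fun_prop)
      intro x hx
      have := ha.trans_le hx.1
      positivity
  refine this.congr fun x hx => ?_
  simp only [rhoMP]
  rw [if_pos ⟨hx.1, hx.2⟩]

/-- Upper bound for the integral defining `c_p`, from `x - c ≥ a - c`. -/
lemma integral_sq_div_mul_rhoMP_le {d c : ℝ} (hd0 : 0 < d) (hd1 : d < 1)
    (hc0 : 0 < c) (hc : c < aMP d) :
    ∫ x in (aMP d)..(bMP d), (c / (x - c)) ^ 2 * rhoMP d x ≤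
      (c / (aMP d - c)) ^ 2 * (8 / (Real.pi * d * aMP d)) := by
  have ha := aMP_pos hd1
  have hs : Real.sqrt d ≤ 1 := Real.sqrt_le_one.2 hd1.le
  have hb := bMP_eq_aMP_add d
  have hab := aMP_le_bMP d
  have hac : 0 < aMP d - c := by linarith
  have hpt : ∀ x ∈ Set.Icc (aMP d) (bMP d), (c / (x - c)) ^ 2 * rhoMP d x ≤
      (c / (aMP d - c)) ^ 2 * (2 / (Real.pi * d * aMP d)) := by
    intro x hx
    have hx1 := hx.1
    have hx2 := hx.2
    have hx0 : 0 < x := ha.trans_le hx.1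
    apply mul_le_mul _ _ (rhoMP_nonneg hd0 hd1 x) (by positivity)
    · have : 0 < x - c := by linarith
      gcongr
    · unfold rhoMP
      rw [if_pos ⟨hx.1, hx.2⟩]
      have h4 : Real.sqrt ((bMP d - x) * (x - aMP d)) ≤ 4 := by
        apply Real.sqrt_le_iff.2 ⟨by norm_num, ?_⟩
        nlinarith
      calc 1 / (2 * Real.pi * d * x) * Real.sqrt ((bMP d - x) * (x - aMP d))
          ≤ 1 / (2 * Real.pi * d * aMP d) * 4 := by gcongr
        _ = 2 / (Real.pi * d * aMP d) := by field_simp; norm_num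
  calc ∫ x in (aMP d)..(bMP d), (c / (x - c)) ^ 2 * rhoMP d x
      ≤ ∫ _ in (aMP d)..(bMP d), (c / (aMP d - c)) ^ 2 * (2 / (Real.pi * d * aMP d)) :=
        intervalIntegral.integral_mono_on hab
          (intervalIntegrable_sq_div_mul_rhoMP hd0 hd1 hc) (by simp) hpt
    _ = (bMP d - aMP d) * ((c / (aMP d - c)) ^ 2 * (2 / (Real.pi * d * aMP d))) := by
        rw [intervalIntegral.integral_const, smul_eq_mul]
    _ ≤ 4 * ((c / (aMP d - c)) ^ 2 * (2 / (Real.pi * d * aMP d))) := by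
        gcongr; linarith
    _ = _ := by ring

/-- Lower bound for the integral defining `c_p`, from the square-root behaviour of the density at
its left edge. -/
lemma sq_mul_sqrt_le_integral_sq_div_mul_rhoMP {d c : ℝ} (hd0 : 0 < d) (hd1 : d < 1)
    (hc0 : 0 < c) (hc : c < aMP d) (hcd : aMP d - c ≤ Real.sqrt d) :
    c ^ 2 * Real.sqrt d ≤ 72 * Real.pi * Real.sqrt (aMP d - c) *
      ∫ x in (aMP d)..(bMP d), (c / (x - c)) ^ 2 * rhoMP d x := by
  have ha := aMP_pos hd1
  have hb := bMP_eq_aMP_add d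
  have hb4 := bMP_le_four hd1.le
  have hs1 : Real.sqrt d ≤ 1 := Real.sqrt_le_one.2 hd1.le
  have hss : Real.sqrt d ^ 2 = d := Real.sq_sqrt hd0.le
  obtain ⟨ε, hε⟩ : ∃ ε, ε = aMP d - c := ⟨_, rfl⟩
  have hε0 : 0 < ε := by linarith
  rw [← hε] at hcd ⊢
  have hint := intervalIntegrable_sq_div_mul_rhoMP hd0 hd1 hc
  have hsub : Set.uIcc (aMP d + ε) (aMP d + 2 * ε) ⊆ Set.uIcc (aMP d) (bMP d) := by
    rw [Set.uIcc_of_le (by linarith), Set.uIcc_of_le (by linarith)]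
    exact Set.Icc_subset_Icc (by linarith) (by linarith)
  have hpt : ∀ x ∈ Set.Icc (aMP d + ε) (aMP d + 2 * ε),
      (c / (3 * ε)) ^ 2 * (1 / (8 * Real.pi) * (Real.sqrt d * Real.sqrt ε)) ≤
        (c / (x - c)) ^ 2 * rhoMP d x := by
    intro x hx
    have hx1 := hx.1
    have hx2 := hx.2
    have hx0 : 0 < x := by linarith
    have hxc : 0 < x - c := by linarith
    have hxc3 : x - c ≤ 3 * ε := by linarith
    have hdx : 2 * Real.pi * d * x ≤ 8 * Real.pi := by
      have : d * x ≤ 4 := by nlinarith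
      nlinarith [Real.pi_pos]
    unfold rhoMP
    rw [if_pos ⟨by linarith, by linarith⟩, ← Real.sqrt_mul hd0.le]
    have hprod : d * ε ≤ (bMP d - x) * (x - aMP d) := by
      apply mul_le_mul _ _ hε0.le <;> nlinarith
    gcongr
  have hlow : ε * ((c / (3 * ε)) ^ 2 * (1 / (8 * Real.pi) * (Real.sqrt d * Real.sqrt ε))) ≤
      ∫ x in (aMP d)..(bMP d), (c / (x - c)) ^ 2 * rhoMP d x := by
    calc ε * ((c / (3 * ε)) ^ 2 * (1 / (8 * Real.pi) * (Real.sqrt d * Real.sqrt ε)))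
        = ∫ _ in (aMP d + ε)..(aMP d + 2 * ε),
            (c / (3 * ε)) ^ 2 * (1 / (8 * Real.pi) * (Real.sqrt d * Real.sqrt ε)) := by
          rw [intervalIntegral.integral_const, smul_eq_mul]; ring
      _ ≤ ∫ x in (aMP d + ε)..(aMP d + 2 * ε), (c / (x - c)) ^ 2 * rhoMP d x :=
          intervalIntegral.integral_mono_on (by linarith) (by simp) (hint.mono_set hsub) hpt
      _ ≤ _ := by
          refine intervalIntegral.integral_mono_interval (by linarith) (by linarith)
            (by linarith) (Eventually.of_forall fun x => ?_) hint
          exact mul_nonneg (sq_nonneg _) (rhoMP_nonneg hd0 hd1 x)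
  have hmul := mul_le_mul_of_nonneg_left hlow
    (by positivity : 0 ≤ 72 * Real.pi * Real.sqrt ε)
  refine le_of_eq_of_le ?_ hmul
  have hεs : Real.sqrt ε ^ 2 = ε := Real.sq_sqrt hε0.le
  calc c ^ 2 * Real.sqrt d = c ^ 2 * Real.sqrt d * (ε / ε) := by
        rw [div_self hε0.ne', mul_one]
    _ = c ^ 2 * Real.sqrt d * (Real.sqrt ε ^ 2 / ε) := by rw [hεs]
    _ = _ := by field_simp; ring

/-- under Condition 3 with `0 < d₁ < 1`, there exist constants `M₀ > 0` and
`M₀'' > 0` such that for all large `p`, `c_p/(a_p − c_p) ≤ M₀` and `c_p ≥ M₀''`;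
in particular `limsup_p c_p/a_p < 1`. -/
theorem stmt_7 (m n : ℕ → ℕ) (d₁ d₂ d₃ : ℝ)
    (hd₁ : d₁ ∈ Set.Ioo (0 : ℝ) 1) (hd₂ : 0 < d₂) (hd₃ : d₃ ∈ Set.Ioo (0 : ℝ) 1)
    (hm : Tendsto (fun p : ℕ => (p : ℝ) / m p) atTop (nhds d₁))
    (hn : Tendsto (fun p : ℕ => (p : ℝ) / n p) atTop (nhds d₂))
    (hmn : Tendsto (fun p : ℕ => (p : ℝ) / ((m p : ℝ) + n p)) atTop (nhds d₃))
    (c : ℕ → ℝ)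
    (hc : ∀ᶠ p : ℕ in atTop,
      c p ∈ Set.Ioo 0 (aMP ((p : ℝ) / m p)) ∧
      (∫ x in (aMP ((p : ℝ) / m p))..(bMP ((p : ℝ) / m p)),
          (c p / (x - c p)) ^ 2 * rhoMP ((p : ℝ) / m p) x) = (n p : ℝ) / p) :
    (∃ M₀ : ℝ, 0 < M₀ ∧ ∃ M₀'' : ℝ, 0 < M₀'' ∧ ∀ᶠ p : ℕ in atTop,
        c p / (aMP ((p : ℝ) / m p) - c p) ≤ M₀ ∧ M₀'' ≤ c p) ∧
      Filter.limsup (fun p : ℕ => c p / aMP ((p : ℝ) / m p)) atTop < 1 := by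
  obtain ⟨hd10, hd11⟩ := hd₁
  have hL : 0 < 1 / d₂ := by positivity
  have hnp : Tendsto (fun p : ℕ => (n p : ℝ) / p) atTop (nhds (1 / d₂)) := by
    have := hn.inv₀ hd₂.ne'
    simpa [one_div] using this
  obtain ⟨L, hLdef⟩ : ∃ L, L = 1 / d₂ := ⟨_, rfl⟩
  rw [← hLdef] at hL hnp
  obtain ⟨l, hl⟩ : ∃ l, l = d₁ / 2 := ⟨_, rfl⟩
  obtain ⟨u, hu⟩ : ∃ u, u = (1 + d₁) / 2 := ⟨_, rfl⟩
  have hl0 : 0 < l := by linarith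
  have hu1 : u < 1 := by linarith
  have ha0 : 0 < aMP u := aMP_pos hu1
  obtain ⟨K, hK⟩ : ∃ K, K = 8 / (Real.pi * l * aMP u) := ⟨_, rfl⟩
  have hK0 : 0 < K := by rw [hK]; positivity
  obtain ⟨δ, hδ⟩ : ∃ δ, δ = Real.sqrt (L / 2 / K) := ⟨_, rfl⟩
  have hδ0 : 0 < δ := by rw [hδ]; exact Real.sqrt_pos.2 (by positivity)
  have hδK : δ ^ 2 * K = L / 2 := by
    rw [hδ, Real.sq_sqrt (by positivity)]; field_simp
  obtain ⟨M, hM⟩ : ∃ M, M = δ * aMP u / (1 + δ) := ⟨_, rfl⟩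
  have hM0 : 0 < M := by rw [hM]; positivity
  obtain ⟨ε, hε⟩ : ∃ ε, ε = min (Real.sqrt l) (M ^ 4 * l / ((72 * Real.pi) ^ 2 * (2 * L) ^ 2)) :=
    ⟨_, rfl⟩
  have hε0 : 0 < ε := by
    rw [hε]; exact lt_min (Real.sqrt_pos.2 hl0) (by positivity)
  have key : ∀ᶠ p : ℕ in atTop, aMP ((p : ℝ) / m p) ≤ 1 ∧ 0 < aMP ((p : ℝ) / m p) ∧
      0 < c p ∧ M ≤ c p ∧ ε ≤ aMP ((p : ℝ) / m p) - c p := by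
    filter_upwards [hc, hm.eventually_const_le (by linarith : l < d₁),
      hm.eventually_le_const (by linarith : d₁ < u),
      hnp.eventually_const_le (by linarith : L / 2 < L),
      hnp.eventually_le_const (by linarith : L < 2 * L)] with p hcp hlp hup hLp hLp'
    obtain ⟨⟨hc0, hca⟩, hI⟩ := hcp
    generalize (p : ℝ) / m p = d at *
    have hd0 : 0 < d := by linarith
    have hd1 : d < 1 := by linarith
    have hau : aMP u ≤ aMP d := aMP_anti hup hu1.le
    have hac : 0 < aMP d - c p := by linarith
    have hMc : M ≤ c p := by
      have h1 := integral_sq_div_mul_rhoMP_le hd0 hd1 hc0 hca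
      have h2 : 8 / (Real.pi * d * aMP d) ≤ K := by rw [hK]; gcongr
      have h3 : δ ^ 2 * K ≤ (c p / (aMP d - c p)) ^ 2 * K := by
        rw [hδK]
        calc L / 2 ≤ _ := hLp
          _ = _ := hI.symm
          _ ≤ _ := h1
          _ ≤ _ := by gcongr
      have h4 : δ ≤ c p / (aMP d - c p) :=
        le_of_sq_le_sq (le_of_mul_le_mul_right h3 hK0) (by positivity)
      rw [le_div_iff₀ hac] at h4
      rw [hM, div_le_iff₀ (by positivity)]
      nlinarith
    refine ⟨aMP_le_one hd1.le, by linarith, hc0, hMc, ?_⟩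
    by_cases hcd : aMP d - c p ≤ Real.sqrt d
    · have h1 := sq_mul_sqrt_le_integral_sq_div_mul_rhoMP hd0 hd1 hc0 hca hcd
      rw [hI] at h1
      have h2 : M ^ 2 * Real.sqrt l ≤
          72 * Real.pi * Real.sqrt (aMP d - c p) * (2 * L) := by
        calc M ^ 2 * Real.sqrt l ≤ c p ^ 2 * Real.sqrt d := by gcongr
          _ ≤ _ := h1
          _ ≤ _ := by gcongr
      have h3 := pow_le_pow_left₀ (by positivity) h2 2
      rw [mul_pow, mul_pow, mul_pow (72 * Real.pi), Real.sq_sqrt hl0.le,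
        Real.sq_sqrt hac.le] at h3
      rw [hε]
      refine (min_le_right _ _).trans ?_
      rw [div_le_iff₀ (by positivity)]
      linarith
    · have := Real.sqrt_le_sqrt hlp
      rw [hε]
      exact (min_le_left _ _).trans (by linarith)
  refine ⟨⟨1 / ε, by positivity, M, hM0, ?_⟩, ?_⟩
  · filter_upwards [key] with p ⟨h1, _, _, hMc, hεc⟩
    exact ⟨div_le_div₀ zero_le_one (by linarith) hε0 hεc, hMc⟩
  · refine lt_of_le_of_lt (limsup_le_of_le (a := 1 - ε) ?_ ?_) (by linarith)
    · refine IsBoundedUnder.isCoboundedUnder_le ⟨0, ?_⟩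
      rw [eventually_map]
      filter_upwards [key] with p ⟨_, ha, hc0, _⟩
      exact (div_pos hc0 ha).le
    · filter_upwards [key] with p ⟨h1, ha, _, _, hεc⟩
      rw [div_le_iff₀ ha]
      nlinarith
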